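/- Let ψ : 𝕋 × ℝ → ℝ be smooth and rapidly decaying in y, with ω = Δψ. Then ‖∂_{xx}ψ‖²_{L²} ≤ ‖y ∂ₓω‖²_{L²} + 2‖∂_{xy}ψ‖²_{L²}. -/

import Mathlib

open MeasureTheory Real

/-- Partial derivative in the first (x) variable. -/
noncomputable def pdx (f : ℝ → ℝ → ℝ) (x y : ℝ) : ℝ := deriv (fun x' => f x' y) x

/-- Partial derivative in the second (y) variable. -/
noncomputable def pdy (f : ℝ → ℝ → ℝ) (x y : ℝ) : ℝ := deriv (fun y' => f x y') y

/-- Laplacian. -/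
noncomputable def lap (f : ℝ → ℝ → ℝ) (x y : ℝ) : ℝ := pdx (pdx f) x y + pdy (pdy f) x y

/-- `f` and all its derivatives decay rapidly in `y`, uniformly in `x`. -/
def RapidDecay (f : ℝ → ℝ → ℝ) : Prop :=
  ∀ k n : ℕ, ∃ C : ℝ, ∀ x y : ℝ,
    |y| ^ n * ‖iteratedFDeriv ℝ k (Function.uncurry f) (x, y)‖ ≤ C

/-- `f` is `2π`-periodic in `x` (i.e. lives on `𝕋 × ℝ`). -/
def PerX (f : ℝ → ℝ → ℝ) : Prop := ∀ y : ℝ, Function.Periodic (fun x => f x y) (2 * π)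

/-- `f` has zero `x`-average. -/
def ZeroAvgX (f : ℝ → ℝ → ℝ) : Prop := ∀ y : ℝ, ∫ x in (0:ℝ)..(2 * π), f x y = 0


structure GoodFn (f : ℝ → ℝ → ℝ) : Prop where
  sm : ContDiff ℝ (⊤ : ℕ∞) (Function.uncurry f)
  per : PerX f
  dec : RapidDecay f

lemma pdx_eq {f : ℝ → ℝ → ℝ} (h : Differentiable ℝ (Function.uncurry f)) (x y : ℝ) :
    HasDerivAt (fun x' => f x' y) (fderiv ℝ (Function.uncurry f) (x, y) (1, 0)) x := by
  have h1 := (h (x, y)).hasFDerivAt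
  have h2 : HasDerivAt (fun x' : ℝ => (x', y)) ((1 : ℝ), (0 : ℝ)) x :=
    (hasDerivAt_id x).prodMk (hasDerivAt_const x y)
  exact h1.comp_hasDerivAt x h2

lemma pdy_eq {f : ℝ → ℝ → ℝ} (h : Differentiable ℝ (Function.uncurry f)) (x y : ℝ) :
    HasDerivAt (fun y' => f x y') (fderiv ℝ (Function.uncurry f) (x, y) (0, 1)) y := by
  have h1 := (h (x, y)).hasFDerivAt
  have h2 : HasDerivAt (fun y' : ℝ => (x, y')) ((0 : ℝ), (1 : ℝ)) y :=
    (hasDerivAt_const y x).prodMk (hasDerivAt_id y)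
  exact h1.comp_hasDerivAt y h2

lemma uncurry_pdx {f : ℝ → ℝ → ℝ} (h : Differentiable ℝ (Function.uncurry f)) :
    Function.uncurry (pdx f) = fun z => fderiv ℝ (Function.uncurry f) z (1, 0) := by
  ext ⟨x, y⟩
  exact (pdx_eq h x y).deriv

lemma uncurry_pdy {f : ℝ → ℝ → ℝ} (h : Differentiable ℝ (Function.uncurry f)) :
    Function.uncurry (pdy f) = fun z => fderiv ℝ (Function.uncurry f) z (0, 1) := by
  ext ⟨x, y⟩
  exact (pdy_eq h x y).deriv

lemma smooth_dir {F : ℝ × ℝ → ℝ} (h : ContDiff ℝ (⊤ : ℕ∞) F) (v : ℝ × ℝ) :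
    ContDiff ℝ (⊤ : ℕ∞) (fun z => fderiv ℝ F z v) :=
  (h.fderiv_right (m := (⊤ : ℕ∞)) (by simp)).clm_apply contDiff_const

lemma dec_dir {F : ℝ × ℝ → ℝ} (h : ContDiff ℝ (⊤ : ℕ∞) F) (v : ℝ × ℝ)
    (hd : ∀ k n : ℕ, ∃ C : ℝ, ∀ x y : ℝ, |y| ^ n * ‖iteratedFDeriv ℝ k F (x, y)‖ ≤ C)
    (k n : ℕ) : ∃ C : ℝ, ∀ x y : ℝ,
      |y| ^ n * ‖iteratedFDeriv ℝ k (fun z => fderiv ℝ F z v) (x, y)‖ ≤ C := by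
  obtain ⟨C, hC⟩ := hd (k + 1) n
  let L : ((ℝ × ℝ) →L[ℝ] ℝ) →L[ℝ] ℝ := ContinuousLinearMap.apply ℝ ℝ v
  refine ⟨‖L‖ * C, fun x y => ?_⟩
  have h1 : ContDiff ℝ (⊤ : ℕ∞) (fderiv ℝ F) := h.fderiv_right (m := (⊤ : ℕ∞)) (by simp)
  have h2 : ‖iteratedFDeriv ℝ k (L ∘ fderiv ℝ F) (x, y)‖ ≤
      ‖L‖ * ‖iteratedFDeriv ℝ k (fderiv ℝ F) (x, y)‖ :=
    L.norm_iteratedFDeriv_comp_left h1.contDiffAt (by exact_mod_cast le_top)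
  rw [norm_iteratedFDeriv_fderiv] at h2
  have h3 : (fun z => fderiv ℝ F z v) = L ∘ fderiv ℝ F := rfl
  rw [h3]
  calc _ ≤ |y| ^ n * (‖L‖ * ‖iteratedFDeriv ℝ (k + 1) F (x, y)‖) := by gcongr
    _ = ‖L‖ * (|y| ^ n * ‖iteratedFDeriv ℝ (k + 1) F (x, y)‖) := by ring
    _ ≤ _ := by gcongr; exact hC x y

lemma GoodFn.diff {f : ℝ → ℝ → ℝ} (h : GoodFn f) : Differentiable ℝ (Function.uncurry f) :=
  h.sm.differentiable (by simp)

lemma GoodFn.dx {f : ℝ → ℝ → ℝ} (h : GoodFn f) : GoodFn (pdx f) := by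
  refine ⟨?_, ?_, ?_⟩
  · rw [uncurry_pdx h.diff]; exact smooth_dir h.sm _
  · intro y x
    have h1 : (fun x' => f (x' + 2 * π) y) = fun x' => f x' y := funext (h.per y)
    change deriv (fun x' => f x' y) (x + 2 * π) = deriv (fun x' => f x' y) x
    rw [← deriv_comp_add_const (f := fun x' => f x' y), h1]
  · intro k n
    rw [uncurry_pdx h.diff]; exact dec_dir h.sm _ h.dec k n

lemma GoodFn.dy {f : ℝ → ℝ → ℝ} (h : GoodFn f) : GoodFn (pdy f) := by
  refine ⟨?_, ?_, ?_⟩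
  · rw [uncurry_pdy h.diff]; exact smooth_dir h.sm _
  · intro y x
    change deriv (fun y' => f (x + 2 * π) y') y = deriv (fun y' => f x y') y
    congr 1
    ext y'
    exact h.per y' x
  · intro k n
    rw [uncurry_pdy h.diff]; exact dec_dir h.sm _ h.dec k n

lemma GoodFn.hdx {f : ℝ → ℝ → ℝ} (h : GoodFn f) (x y : ℝ) :
    HasDerivAt (fun x' => f x' y) (pdx f x y) x :=
  (pdx_eq h.diff x y).differentiableAt.hasDerivAt

lemma GoodFn.hdy {f : ℝ → ℝ → ℝ} (h : GoodFn f) (x y : ℝ) :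
    HasDerivAt (fun y' => f x y') (pdy f x y) y :=
  (pdy_eq h.diff x y).differentiableAt.hasDerivAt

lemma GoodFn.comm {f : ℝ → ℝ → ℝ} (h : GoodFn f) : pdx (pdy f) = pdy (pdx f) := by
  ext x y
  have e1 := congrFun (uncurry_pdx h.dy.diff) (x, y)
  have e2 := congrFun (uncurry_pdy h.dx.diff) (x, y)
  simp only [Function.uncurry_apply_pair] at e1 e2
  rw [e1, e2, uncurry_pdx h.diff, uncurry_pdy h.diff]
  have hd : DifferentiableAt ℝ (fderiv ℝ (Function.uncurry f)) (x, y) :=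
    ((h.sm.fderiv_right (m := (⊤ : ℕ∞)) (by simp)).differentiable (by simp)) _
  rw [fderiv_clm_apply hd (by fun_prop), fderiv_clm_apply hd (by fun_prop)]
  have hs : IsSymmSndFDerivAt ℝ (Function.uncurry f) (x, y) :=
    h.sm.contDiffAt.isSymmSndFDerivAt (by simp; exact WithTop.coe_le_coe.2 le_top)
  simpa using hs (1, 0) (0, 1)

lemma GoodFn.cont {f : ℝ → ℝ → ℝ} (h : GoodFn f) : Continuous (Function.uncurry f) :=
  h.sm.continuous

/-- quadratic decay -/
def QDec (f : ℝ → ℝ → ℝ) : Prop :=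
  Continuous (Function.uncurry f) ∧ ∃ C : ℝ, ∀ x y : ℝ, (1 + y ^ 2) * |f x y| ≤ C

lemma GoodFn.q {f : ℝ → ℝ → ℝ} (h : GoodFn f) : QDec f := by
  refine ⟨h.cont, ?_⟩
  obtain ⟨C, hC⟩ := h.dec 0 0
  obtain ⟨D, hD⟩ := h.dec 0 2
  refine ⟨C + D, fun x y => ?_⟩
  have a := hC x y
  have b := hD x y
  simp only [norm_iteratedFDeriv_zero, Function.uncurry_apply_pair, Real.norm_eq_abs, sq_abs,
    pow_zero, one_mul] at a b
  linarith

lemma QDec.add {f g : ℝ → ℝ → ℝ} (hf : QDec f) (hg : QDec g) :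
    QDec (fun x y => f x y + g x y) := by
  obtain ⟨cf, C, hC⟩ := hf
  obtain ⟨cg, D, hD⟩ := hg
  refine ⟨cf.add cg, C + D, fun x y => ?_⟩
  have := abs_add_le (f x y) (g x y)
  have h2 : 0 ≤ 1 + y ^ 2 := by positivity
  nlinarith [hC x y, hD x y, mul_le_mul_of_nonneg_left this h2]

lemma QDec.const_mul {f : ℝ → ℝ → ℝ} (hf : QDec f) (c : ℝ) :
    QDec (fun x y => c * f x y) := by
  obtain ⟨cf, C, hC⟩ := hf
  refine ⟨cf.const_mul c, |c| * C, fun x y => ?_⟩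
  rw [abs_mul]
  nlinarith [mul_le_mul_of_nonneg_left (hC x y) (abs_nonneg c)]

/-- weight bounded by `1 + y^2` times a product is fine -/
lemma QDec.wmul {f g : ℝ → ℝ → ℝ} (hf : QDec f) (hg : QDec g) (w : ℝ → ℝ)
    (hw : Continuous w) (hwb : ∀ y, |w y| ≤ 1 + y ^ 2) :
    QDec (fun x y => w y * (f x y * g x y)) := by
  obtain ⟨cf, C, hC⟩ := hf
  obtain ⟨cg, D, hD⟩ := hg
  refine ⟨(hw.comp continuous_snd).mul (cf.mul cg), C * D, fun x y => ?_⟩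
  have h2 : 0 ≤ 1 + y ^ 2 := by positivity
  rw [abs_mul, abs_mul]
  calc (1 + y ^ 2) * (|w y| * (|f x y| * |g x y|))
      ≤ (1 + y ^ 2) * ((1 + y ^ 2) * (|f x y| * |g x y|)) := by gcongr; exact hwb y
    _ = ((1 + y ^ 2) * |f x y|) * ((1 + y ^ 2) * |g x y|) := by ring
    _ ≤ C * D := mul_le_mul (hC x y) (hD x y) (by positivity)
        (le_trans (by positivity) (hC x y))

lemma QDec.mul {f g : ℝ → ℝ → ℝ} (hf : QDec f) (hg : QDec g) :
    QDec (fun x y => f x y * g x y) := by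
  simpa using hf.wmul hg (fun _ => 1) continuous_const (fun y => by simp; positivity)

lemma QDec.ymul {f g : ℝ → ℝ → ℝ} (hf : QDec f) (hg : QDec g) :
    QDec (fun x y => y * (f x y * g x y)) :=
  hf.wmul hg (fun y => y) continuous_id (fun y => by
    rw [abs_le]; constructor <;> nlinarith [sq_nonneg (y - 1), sq_nonneg (y + 1)])

lemma QDec.y2mul {f g : ℝ → ℝ → ℝ} (hf : QDec f) (hg : QDec g) :
    QDec (fun x y => y ^ 2 * (f x y * g x y)) :=
  hf.wmul hg (fun y => y ^ 2) (by fun_prop) (fun y => by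
    rw [abs_of_nonneg (sq_nonneg y)]; linarith)

lemma QDec.bound {f : ℝ → ℝ → ℝ} (hf : QDec f) :
    ∃ C : ℝ, ∀ x y : ℝ, ‖f x y‖ ≤ C * (1 + y ^ 2)⁻¹ := by
  obtain ⟨_, C, hC⟩ := hf
  refine ⟨C, fun x y => ?_⟩
  have h2 : 0 < 1 + y ^ 2 := by positivity
  rw [← div_eq_mul_inv, le_div_iff₀ h2, Real.norm_eq_abs, mul_comm]
  exact hC x y

lemma QDec.int_y {f : ℝ → ℝ → ℝ} (hf : QDec f) (x : ℝ) : Integrable (fun y => f x y) := by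
  obtain ⟨C, hC⟩ := hf.bound
  have hc : Continuous (fun y => f x y) := hf.1.comp (by fun_prop : Continuous fun y : ℝ => (x, y))
  exact (integrable_inv_one_add_sq.const_mul C).mono' hc.aestronglyMeasurable
    (Filter.Eventually.of_forall fun y => hC x y)

noncomputable abbrev muX : Measure ℝ := volume.restrict (Set.Ioc 0 (2 * π))

lemma QDec.int_prod {f : ℝ → ℝ → ℝ} (hf : QDec f) :
    Integrable (fun z : ℝ × ℝ => f z.2 z.1) ((volume : Measure ℝ).prod muX) := by
  obtain ⟨C, hC⟩ := hf.bound
  have hc : Continuous (fun z : ℝ × ℝ => f z.2 z.1) := hf.1.comp continuous_swap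
  have hi : Integrable (fun z : ℝ × ℝ => (C * (1 + z.1 ^ 2)⁻¹) * (1 : ℝ))
      ((volume : Measure ℝ).prod muX) :=
    (integrable_inv_one_add_sq.const_mul C).mul_prod (integrable_const (1 : ℝ))
  refine hi.mono' hc.aestronglyMeasurable (Filter.Eventually.of_forall fun z => ?_)
  simpa using hC z.2 z.1

lemma QDec.eq_prod {f : ℝ → ℝ → ℝ} (hf : QDec f) :
    ∫ y : ℝ, ∫ x in (0:ℝ)..(2 * π), f x y =
      ∫ z : ℝ × ℝ, f z.2 z.1 ∂((volume : Measure ℝ).prod muX) := by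
  rw [integral_prod _ hf.int_prod]
  congr 1
  ext y
  rw [intervalIntegral.integral_of_le (by positivity)]

lemma key (φ : ℝ → ℝ → ℝ) (h : GoodFn φ) :
    (∫ y : ℝ, ∫ x in (0:ℝ)..(2 * π), (pdx φ x y) ^ 2) ≤
      (∫ y : ℝ, ∫ x in (0:ℝ)..(2 * π), (y * (pdx (pdx φ) x y + pdy (pdy φ) x y)) ^ 2)
        + 2 * (∫ y : ℝ, ∫ x in (0:ℝ)..(2 * π), (pdy φ x y) ^ 2) := by
  have q1 : QDec (fun x y => (pdx φ x y) ^ 2) := by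
    simpa only [sq] using h.dx.q.mul h.dx.q
  have q2 : QDec (fun x y => (y * (pdx (pdx φ) x y + pdy (pdy φ) x y)) ^ 2) := by
    have hs := h.dx.dx.q.add h.dy.dy.q
    convert hs.y2mul hs using 3
    ring
  have q3 : QDec (fun x y => (pdy φ x y) ^ 2) := by
    simpa only [sq] using h.dy.q.mul h.dy.q
  -- the y-divergence part
  let P : ℝ → ℝ → ℝ := fun x y => ((pdy φ x y) ^ 2 + 2 * (y * (pdy φ x y * pdy (pdy φ) x y)))
    + (-1) * ((pdx φ x y) ^ 2 + 2 * (y * (pdx φ x y * pdy (pdx φ) x y)))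
  let Q : ℝ → ℝ → ℝ := fun x y => 2 * (y * (pdx (pdx φ) x y * pdy φ x y))
    + 2 * (y * (pdx φ x y * pdy (pdx φ) x y))
  let G : ℝ → ℝ → ℝ := fun x y => y * (pdy φ x y * pdy φ x y)
    + (-1) * (y * (pdx φ x y * pdx φ x y))
  have qP : QDec P := (q3.add ((h.dy.q.ymul h.dy.dy.q).const_mul 2)).add
    ((q1.add ((h.dx.q.ymul h.dx.dy.q).const_mul 2)).const_mul (-1))
  have qQ : QDec Q := ((h.dx.dx.q.ymul h.dy.q).const_mul 2).add
    ((h.dx.q.ymul h.dx.dy.q).const_mul 2)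
  have qG : QDec G := (h.dy.q.ymul h.dy.q).add ((h.dx.q.ymul h.dx.q).const_mul (-1))
  have hQ0 : ∫ y : ℝ, ∫ x in (0:ℝ)..(2 * π), Q x y = 0 := by
    have : ∀ y : ℝ, ∫ x in (0:ℝ)..(2 * π), Q x y = 0 := by
      intro y
      have hder : ∀ x ∈ Set.uIcc (0:ℝ) (2 * π),
          HasDerivAt (fun x' => 2 * (y * (pdx φ x' y * pdy φ x' y))) (Q x y) x := by
        intro x _
        have := (((h.dx.hdx x y).mul (h.dy.hdx x y)).const_mul y).const_mul 2
        rw [h.comm] at this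
        refine HasDerivAt.congr_deriv this ?_
        simp only [Q]; ring
      have hc : Continuous (fun x => Q x y) :=
        qQ.1.comp (by fun_prop : Continuous fun x : ℝ => (x, y))
      rw [intervalIntegral.integral_eq_sub_of_hasDerivAt hder (hc.intervalIntegrable _ _)]
      have p1 := h.dx.per y 0
      have p2 := h.dy.per y 0
      simp only [zero_add] at p1 p2
      rw [p1, p2, sub_self]
    simp [this]
  have hP0 : ∫ y : ℝ, ∫ x in (0:ℝ)..(2 * π), P x y = 0 := by
    rw [qP.eq_prod, integral_prod_symm _ qP.int_prod]
    have : ∀ x : ℝ, ∫ y : ℝ, P x y = 0 := by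
      intro x
      refine integral_eq_zero_of_hasDerivAt_of_integrable (f := fun y => G x y) (fun y => ?_)
        (qP.int_y x) (qG.int_y x)
      have a := (hasDerivAt_id y).mul ((h.dy.hdy x y).mul (h.dy.hdy x y))
      have b := ((hasDerivAt_id y).mul ((h.dx.hdy x y).mul (h.dx.hdy x y))).const_mul (-1)
      refine HasDerivAt.congr_deriv (a.add b) ?_
      simp only [P, id, Pi.mul_apply]
      ring
    simp [this]
  rw [qP.eq_prod] at hP0
  rw [qQ.eq_prod] at hQ0
  rw [q1.eq_prod, q2.eq_prod, q3.eq_prod]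
  have hmono := integral_mono ((q1.int_prod.add qP.int_prod).add qQ.int_prod)
    (q2.int_prod.add (q3.int_prod.const_mul 2)) (fun z => by
      simp only [Pi.add_apply, P, Q]
      nlinarith [sq_nonneg (z.1 * (pdx (pdx φ) z.2 z.1 + pdy (pdy φ) z.2 z.1) - pdy φ z.2 z.1)])
  rw [integral_add' (q1.int_prod.add qP.int_prod) qQ.int_prod,
    integral_add' q1.int_prod qP.int_prod,
    integral_add' q2.int_prod (q3.int_prod.const_mul 2), hP0, hQ0, integral_const_mul] at hmono
  simpa using hmono

/-- `‖∂ₓₓψ‖² ≤ ‖y ∂ₓω‖² + 2‖∂ₓyψ‖²` where `ω = Δψ`. -/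
theorem stmt6 (ψ : ℝ → ℝ → ℝ)
    (hsmooth : ContDiff ℝ (⊤ : ℕ∞) (Function.uncurry ψ))
    (hper : PerX ψ) (hdecay : RapidDecay ψ) :
    (∫ y : ℝ, ∫ x in (0:ℝ)..(2 * π), (pdx (pdx ψ) x y) ^ 2) ≤
      (∫ y : ℝ, ∫ x in (0:ℝ)..(2 * π), (y * pdx (lap ψ) x y) ^ 2)
        + 2 * (∫ y : ℝ, ∫ x in (0:ℝ)..(2 * π), (pdy (pdx ψ) x y) ^ 2) := by
  have h : GoodFn ψ := ⟨hsmooth, hper, hdecay⟩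
  have e : ∀ x y, pdx (lap ψ) x y = pdx (pdx (pdx ψ)) x y + pdy (pdy (pdx ψ)) x y := by
    intro x y
    have := ((h.dx.dx.hdx x y).add (h.dy.dy.hdx x y)).deriv
    rw [h.dy.comm, h.comm] at this
    exact this
  simp only [e]
  exact key (pdx ψ) h.dx
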